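/- arXiv:0711.0229 — 2 statements merged into one kernel-verified Lean document; each statement's English description precedes it below -/
import Mathlib

section
/- Let n be a natural number and let R be the commutative ring of entire functions on ℂⁿ. If I is a nonzero ideal of R which is stable under every partial derivative (f ∈ I implies ∂f/∂z_j ∈ I for all j : Fin n), then I has no common zeros: for every x ∈ ℂⁿ there exists f ∈ I with f(x) ≠ 0. -/
/-- The commutative ring of entire functions on `ℂⁿ` (realized as `Fin n → ℂ`),
as a subalgebra of all functions `(Fin n → ℂ) → ℂ` with pointwise operations. -/
def Entire (n : ℕ) : Subalgebra ℂ ((Fin n → ℂ) → ℂ) where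
  carrier := {f | Differentiable ℂ f}
  mul_mem' hf hg := hf.mul hg
  add_mem' hf hg := hf.add hg
  algebraMap_mem' c := differentiable_const c

open Metric MeasureTheory

section EntireFunctions

variable {E : Type*} [NormedAddCommGroup E] [NormedSpace ℂ E] {f : E → ℂ}

lemma hasDerivAt_comp_add_smul (hf : Differentiable ℂ f) (z v : E) (t : ℂ) :
    HasDerivAt (fun s : ℂ => f (z + s • v)) (fderiv ℂ f (z + t • v) v) t := by
  have h : HasDerivAt (fun s : ℂ => z + s • v) v t := by
    simpa using ((hasDerivAt_id t).smul_const v).const_add z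
  exact (hf (z + t • v)).hasFDerivAt.comp_hasDerivAt t h

lemma differentiable_comp_add_smul (hf : Differentiable ℂ f) (z v : E) :
    Differentiable ℂ (fun s : ℂ => f (z + s • v)) :=
  fun t => (hasDerivAt_comp_add_smul hf z v t).differentiableAt

/-- Cauchy's estimate for the Fréchet derivative. -/
lemma norm_fderiv_le_of_forall_mem_closedBall (hf : Differentiable ℂ f) {z : E} {C : ℝ}
    (hC : ∀ w ∈ closedBall z 1, ‖f w‖ ≤ C) : ‖fderiv ℂ f z‖ ≤ C := by
  have hC0 : 0 ≤ C := (norm_nonneg _).trans (hC z (mem_closedBall_self zero_le_one))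
  refine ContinuousLinearMap.opNorm_le_bound _ hC0 fun v => ?_
  rcases eq_or_ne v 0 with rfl | hv
  · simp
  have hv' : 0 < ‖v‖ := norm_pos_iff.2 hv
  have h := Complex.norm_deriv_le_of_forall_mem_sphere_norm_le (c := 0) (C := C)
    (inv_pos.2 hv') (differentiable_comp_add_smul hf z v).diffContOnCl fun t ht => hC _ (by
      rw [mem_sphere_zero_iff_norm] at ht
      rw [mem_closedBall, dist_eq_norm, add_sub_cancel_left, norm_smul, ht,
        inv_mul_cancel₀ hv'.ne'])
  rw [(hasDerivAt_comp_add_smul hf z v 0).deriv] at h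
  simpa using h

lemma exists_norm_fderiv_le_on_closedBall [ProperSpace E] (hf : Differentiable ℂ f) (z : E)
    (r : ℝ) : ∃ C, ∀ w ∈ closedBall z r, ‖fderiv ℂ f w‖ ≤ C := by
  obtain ⟨C, hC⟩ := (isCompact_closedBall z (1 + r)).exists_bound_of_continuousOn
    hf.continuous.continuousOn
  exact ⟨C, fun w hw => norm_fderiv_le_of_forall_mem_closedBall hf fun u hu => hC u <| by
    rw [mem_closedBall] at *
    linarith [dist_triangle u w z]⟩

lemma fderiv_apply_eq_circleIntegral (hf : Differentiable ℂ f) (z v : E) :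
    fderiv ℂ f z v = (2 * Real.pi * Complex.I : ℂ)⁻¹ •
      ∮ t in C(0, 1), t ^ (-2 : ℤ) • f (z + t • v) := by
  have h := DiffContOnCl.deriv_eq_smul_circleIntegral (c := 0) one_pos
    (differentiable_comp_add_smul hf z v).diffContOnCl
  rw [(hasDerivAt_comp_add_smul hf z v 0).deriv] at h
  have hpow : ∀ t : ℂ, 1 / (t - 0) ^ 2 = t ^ (-2 : ℤ) := fun t => by simp [zpow_neg]
  simp only [hpow] at h
  rw [h, inv_smul_smul₀ Complex.two_pi_I_ne_zero, zero_smul, add_zero]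

/-- Directional derivatives of an entire function are entire. -/
lemma differentiable_fderiv_apply_const [FiniteDimensional ℂ E] (hf : Differentiable ℂ f)
    (v : E) : Differentiable ℂ (fun z => fderiv ℂ f z v) := by
  have : ProperSpace E := FiniteDimensional.proper_rclike ℂ E
  borelize E
  simp_rw [fderiv_apply_eq_circleIntegral hf _ v]
  suffices h : Differentiable ℂ fun z => ∮ t in C(0, 1), t ^ (-2 : ℤ) • f (z + t • v) from
    h.fun_const_smul _
  intro z
  obtain ⟨C, hC⟩ := exists_norm_fderiv_le_on_closedBall hf z (1 + ‖v‖)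
  have hγ : Continuous fun θ : ℝ => deriv (circleMap 0 1) θ * (circleMap 0 1 θ) ^ (-2 : ℤ) := by
    simp only [deriv_circleMap]
    refine ((continuous_circleMap 0 1).mul continuous_const).mul
      ((continuous_circleMap 0 1).zpow₀ _ fun θ => Or.inl (circleMap_ne_center one_ne_zero))
  have hnorm : ∀ θ : ℝ, ‖deriv (circleMap 0 1) θ * (circleMap 0 1 θ) ^ (-2 : ℤ)‖ = 1 := by
    intro θ
    simp [deriv_circleMap]
  have hF : ∀ x : E, Continuous fun θ : ℝ =>
      (deriv (circleMap 0 1) θ * (circleMap 0 1 θ) ^ (-2 : ℤ)) • f (x + circleMap 0 1 θ • v) :=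
    fun x => hγ.smul (hf.continuous.comp
      (continuous_const.add ((continuous_circleMap 0 1).smul continuous_const)))
  have key := intervalIntegral.hasFDerivAt_integral_of_dominated_of_fderiv_le
    (𝕜 := ℂ) (μ := volume) (a := 0) (b := 2 * Real.pi) (x₀ := z) (s := ball z 1)
    (bound := fun _ => C)
    (F := fun x θ =>
      (deriv (circleMap 0 1) θ * (circleMap 0 1 θ) ^ (-2 : ℤ)) • f (x + circleMap 0 1 θ • v))
    (F' := fun x θ => (deriv (circleMap 0 1) θ * (circleMap 0 1 θ) ^ (-2 : ℤ)) •
      fderiv ℂ f (x + circleMap 0 1 θ • v))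
    (ball_mem_nhds z one_pos) (.of_forall fun x => (hF x).aestronglyMeasurable)
    ((hF z).intervalIntegrable _ _) ?_ (.of_forall fun θ _ x hx => ?_)
    intervalIntegrable_const (.of_forall fun θ _ x _ => ?_)
  · simpa only [circleIntegral, smul_smul] using key.differentiableAt
  · have h : Measurable fun θ : ℝ => fderiv ℂ f (z + circleMap 0 1 θ • v) :=
      (measurable_fderiv ℂ f).comp
        (continuous_const.add ((continuous_circleMap 0 1).smul continuous_const)).measurable
    exact hγ.aestronglyMeasurable.smul h.aestronglyMeasurable
  · rw [norm_smul, hnorm, one_mul]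
    refine hC _ ?_
    rw [mem_ball, dist_eq_norm] at hx
    rw [mem_closedBall, dist_eq_norm, add_sub_right_comm]
    refine (norm_add_le _ _).trans (add_le_add hx.le ?_)
    simp [norm_smul]
  · exact ((hasFDerivAt_comp_add_right _).2 (hf _).hasFDerivAt).fun_const_smul
      (deriv (circleMap 0 1) θ * (circleMap 0 1 θ) ^ (-2 : ℤ))

end EntireFunctions

namespace Entire

variable {n : ℕ}

/-- The directional derivative of an entire function, as an entire function. -/
noncomputable def dirDeriv (v : Fin n → ℂ) (f : Entire n) : Entire n :=
  ⟨fun z => fderiv ℂ f.1 z v, differentiable_fderiv_apply_const f.2 v⟩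

lemma dirDeriv_eq_sum (v : Fin n → ℂ) (f : Entire n) :
    dirDeriv v f = ∑ j, algebraMap ℂ (Entire n) (v j) * dirDeriv (Pi.single j 1) f := by
  ext z
  have h : v = ∑ j, v j • (Pi.single j 1 : Fin n → ℂ) := pi_eq_sum_univ' v
  simp only [← Algebra.smul_def, AddSubmonoidClass.coe_finsetSum, Finset.sum_apply,
    SetLike.val_smul, Pi.smul_apply, dirDeriv]
  conv_lhs => rw [h]
  simp [map_sum]

lemma iteratedDeriv_line_eq_zero {I : Ideal (Entire n)} {x v : Fin n → ℂ}
    (hD : ∀ f ∈ I, dirDeriv v f ∈ I) (hx : ∀ f ∈ I, f.1 x = 0) (k : ℕ) :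
    ∀ f ∈ I, iteratedDeriv k (fun t : ℂ => f.1 (x + t • v)) 0 = 0 := by
  induction k with
  | zero => intro f hf; simpa using hx f hf
  | succ k ih =>
    intro f hf
    rw [iteratedDeriv_succ']
    have h : deriv (fun t : ℂ => f.1 (x + t • v)) = fun t => (dirDeriv v f).1 (x + t • v) :=
      funext fun t => (hasDerivAt_comp_add_smul f.2 x v t).deriv
    rw [h]
    exact ih _ (hD f hf)

end Entire

/-- A nonzero ideal `I` of the ring of entire functions on `ℂⁿ` which is stable
under every partial derivative `∂/∂z_j` has no common zeros: for every `x ∈ ℂⁿ` there is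
`f ∈ I` with `f x ≠ 0`. -/
theorem pderiv_stable_ideal_has_no_common_zero
    (n : ℕ) (I : Ideal (Entire n)) (hI : I ≠ ⊥)
    (hstab : ∀ f ∈ I, ∀ j : Fin n,
      ∀ g : Entire n,
        (∀ z : Fin n → ℂ, (g : (Fin n → ℂ) → ℂ) z
            = fderiv ℂ (f : (Fin n → ℂ) → ℂ) z (Pi.single j 1)) →
        g ∈ I) :
    ∀ x : Fin n → ℂ, ∃ f ∈ I, (f : (Fin n → ℂ) → ℂ) x ≠ 0 := by
  intro x
  by_contra! hx
  refine hI ((Submodule.eq_bot_iff I).2 fun f hf => ?_)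
  ext y
  have hD : ∀ g ∈ I, Entire.dirDeriv (y - x) g ∈ I := fun g hg => by
    rw [Entire.dirDeriv_eq_sum]
    exact I.sum_mem fun j _ => I.mul_mem_left _ (hstab g hg j _ fun _ => rfl)
  have h := Complex.taylorSeries_eq_of_entire' 0 1
    (differentiable_comp_add_smul f.2 x (y - x))
  simp only [Entire.iteratedDeriv_line_eq_zero hD hx _ f hf] at h
  simpa using h.symm
end

section
/- Let Y ⊆ ℂ be open and let F ⊆ Y be closed in Y. Let E(Y) denote the ℂ-vector space of functions f : ℂ → ℂ that are smooth on Y in the real sense (ContDiffOn ℝ ⊤ f Y), let N_F ⊆ E(Y) be the subspace of functions all of whose iterated real Fréchet derivatives (computed within Y) vanish at every point of F (functions flat on F), and let ∂̄ : E(Y) → E(Y) be the Cauchy–Riemann operator (∂̄f)(z) = (1/2)·((fderiv ℝ f z)(1) + I·(fderiv ℝ f z)(I)) for z ∈ Y. Then the quotient ℂ-vector space E(Y) / (∂̄(E(Y)) + N_F), representing the Whitney Dolbeault cohomology group H^{0,1}(𝔚_F), is either zero or infinite dimensional: if it is finite dimensional over ℂ, it is zero. -/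
/-- The Cauchy–Riemann (Wirtinger) operator `∂̄` on functions `ℂ → ℂ`, with respect to the
real Fréchet derivative: `(∂̄ f)(z) = (1/2) ((fderiv ℝ f z)(1) + I • (fderiv ℝ f z)(I))`. -/
noncomputable def dbar (f : ℂ → ℂ) : ℂ → ℂ :=
  fun z => (1 / 2 : ℂ) * (fderiv ℝ f z 1 + Complex.I * fderiv ℝ f z Complex.I)

/-- `E(Y)`: the `ℂ`-vector space of functions `ℂ → ℂ` that are smooth on `Y` in the real
sense, as a subspace of all functions `ℂ → ℂ`. -/
noncomputable def smoothOnSubmodule (Y : Set ℂ) : Submodule ℂ (ℂ → ℂ) where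
  carrier := {f | ContDiffOn ℝ (⊤ : ℕ∞) f Y}
  add_mem' hf hg := hf.add hg
  zero_mem' := contDiffOn_const
  smul_mem' c f hf := hf.const_smul c

/-- The subspace `∂̄(E(Y)) + N_F` of `E(Y)`: the span of the functions that agree on `Y` with
`∂̄ f` for some `f ∈ E(Y)`, together with the functions in `N_F`, i.e. those all of whose
iterated real derivatives (computed within `Y`) vanish at every point of `F` (flat on `F`). -/
noncomputable def dbarImageAddFlat (Y F : Set ℂ) :
    Submodule ℂ (smoothOnSubmodule Y) :=
  Submodule.span ℂ
    ({h : smoothOnSubmodule Y | ∃ f : smoothOnSubmodule Y,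
        Set.EqOn (h : ℂ → ℂ) (dbar (f : ℂ → ℂ)) Y} ∪
     {h : smoothOnSubmodule Y | ∀ x ∈ F, ∀ k : ℕ,
        iteratedFDerivWithin ℝ k (h : ℂ → ℂ) Y x = 0})

open MeasureTheory Set Filter Topology
open scoped Convolution

/-- A continuous function of polar coordinates vanishing for large radius is integrable. -/
theorem integrableOn_polar_of_continuous {f : ℝ × ℝ → ℂ} (hf : Continuous f) {R : ℝ}
    (hR : ∀ p : ℝ × ℝ, R < p.1 → f p = 0) :
    IntegrableOn f (Ioi (0 : ℝ) ×ˢ Ioo (-Real.pi) Real.pi) := by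
  have hK : IsCompact (Icc (0 : ℝ) R ×ˢ Icc (-Real.pi) Real.pi) := isCompact_Icc.prod isCompact_Icc
  refine IntegrableOn.of_forall_sdiff_eq_zero (hf.continuousOn.integrableOn_compact hK)
    (measurableSet_Ioi.prod measurableSet_Ioo) ?_
  rintro ⟨r, θ⟩ ⟨⟨h1, h2⟩, h3⟩
  apply hR
  by_contra h
  exact h3 ⟨⟨h1.le, not_lt.1 h⟩, h2.1.le, h2.2.le⟩

theorem locallyIntegrable_inv_complex : LocallyIntegrable (fun z : ℂ => z⁻¹) := by
  refine locallyIntegrable_of_norm_le_rpow (C := 1) (α := 1) (by simp) (by simp)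
    (Eventually.of_forall fun x => ?_) measurable_inv.aestronglyMeasurable
  simp [Real.rpow_neg_one]

theorem integral_radial_fderiv {G : ℂ → ℂ} (hG : ContDiff ℝ 1 G) {R : ℝ}
    (hR : ∀ z : ℂ, R < ‖z‖ → fderiv ℝ G z = 0) (hR' : ∀ z : ℂ, R < ‖z‖ → G z = 0)
    {e : ℂ} (he : ‖e‖ = 1) :
    ∫ r in Ioi (0 : ℝ), fderiv ℝ G (r * e) e = -G 0 := by
  have hder : ∀ r : ℝ, HasDerivAt (fun r : ℝ => G (r * e)) (fderiv ℝ G (r * e) e) r := by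
    intro r
    have h1 : HasDerivAt (fun r : ℝ => (r : ℂ) * e) e r := by
      simpa using (Complex.ofRealCLM.hasDerivAt (x := r)).mul_const e
    exact ((hG.differentiable one_ne_zero _).hasFDerivAt).comp_hasDerivAt r h1
  have hcont : Continuous fun r : ℝ => fderiv ℝ G (r * e) e := by
    have := hG.continuous_fderiv one_ne_zero
    fun_prop
  have hnorm : ∀ r : ℝ, R < r → R < ‖(r : ℂ) * e‖ := by
    intro r hr
    rw [norm_mul, he, mul_one, Complex.norm_real]
    exact hr.trans_le (le_abs_self r)
  have hint : IntegrableOn (fun r : ℝ => fderiv ℝ G (r * e) e) (Ioi 0) := by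
    refine IntegrableOn.of_forall_sdiff_eq_zero
      (hcont.continuousOn.integrableOn_compact (isCompact_Icc (a := 0) (b := R)))
      measurableSet_Ioi ?_
    rintro r ⟨h1, h2⟩
    rw [hR _ (hnorm r _)]
    · rfl
    · by_contra h
      exact h2 ⟨le_of_lt h1, not_lt.1 h⟩
  have hlim : Tendsto (fun r : ℝ => G (r * e)) atTop (𝓝 0) := by
    refine tendsto_const_nhds.congr' ?_
    filter_upwards [Ioi_mem_atTop R] with r hr
    exact (hR' _ (hnorm r hr)).symm
  simpa using integral_Ioi_of_hasDerivAt_of_tendsto' (fun r _ => hder r) hint hlim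

theorem integral_angular_fderiv {G : ℂ → ℂ} (hG : ContDiff ℝ 1 G) {r : ℝ} (hr : 0 < r) :
    ∫ θ in Ioo (-Real.pi) Real.pi,
      fderiv ℝ G (r * Complex.exp (θ * Complex.I)) (Complex.I * Complex.exp (θ * Complex.I)) = 0 := by
  have hder : ∀ θ : ℝ, HasDerivAt (fun θ : ℝ => G (r * Complex.exp (θ * Complex.I)))
      (r • fderiv ℝ G (r * Complex.exp (θ * Complex.I))
        (Complex.I * Complex.exp (θ * Complex.I))) θ := by
    intro θ
    have h1 : HasDerivAt (fun θ : ℝ => (r : ℂ) * Complex.exp (θ * Complex.I))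
        (r • (Complex.I * Complex.exp (θ * Complex.I))) θ := by
      have h0 : HasDerivAt (fun θ : ℝ => (θ : ℂ) * Complex.I) Complex.I θ := by
        simpa using (Complex.ofRealCLM.hasDerivAt (x := θ)).mul_const Complex.I
      have h2 := h0.cexp.const_mul (r : ℂ)
      rwa [show (r : ℂ) * (Complex.exp (θ * Complex.I) * Complex.I) =
        r • (Complex.I * Complex.exp (θ * Complex.I)) by rw [Complex.real_smul]; ring] at h2
    rw [← map_smul]
    exact ((hG.differentiable one_ne_zero _).hasFDerivAt).comp_hasDerivAt θ h1
  have hcont : Continuous fun θ : ℝ => r • fderiv ℝ G (r * Complex.exp (θ * Complex.I))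
        (Complex.I * Complex.exp (θ * Complex.I)) := by
    have := hG.continuous_fderiv one_ne_zero
    fun_prop
  have key := intervalIntegral.integral_eq_sub_of_hasDerivAt (a := -Real.pi) (b := Real.pi)
    (fun θ _ => hder θ) (hcont.intervalIntegrable _ _)
  rw [intervalIntegral.integral_of_le (by linarith [Real.pi_pos]),
    integral_Ioc_eq_integral_Ioo, integral_smul] at key
  have h2 : Complex.exp (((-Real.pi : ℝ) : ℂ) * Complex.I) = Complex.exp ((Real.pi : ℂ) * Complex.I) := by
    rw [Complex.ofReal_neg, neg_mul, Complex.exp_neg, Complex.exp_pi_mul_I]; norm_num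
  rw [h2, sub_self] at key
  exact (smul_eq_zero.1 key).resolve_left hr.ne'

/-- The Cauchy–Pompeiu formula at the origin, for compactly supported functions. -/
theorem integral_inv_mul_dbar {G : ℂ → ℂ} (hG : ContDiff ℝ 1 G) (hc : HasCompactSupport G) :
    ∫ z : ℂ, z⁻¹ * dbar G z = -(Real.pi : ℂ) * G 0 := by
  obtain ⟨R, hR⟩ : ∃ R : ℝ, tsupport G ⊆ Metric.closedBall 0 R :=
    hc.isBounded.subset_closedBall 0
  have hnot : ∀ z : ℂ, R < ‖z‖ → z ∉ tsupport G := fun z hz h => by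
    have := hR h
    rw [mem_closedBall_zero_iff] at this
    linarith
  have hR' : ∀ z : ℂ, R < ‖z‖ → G z = 0 := fun z hz => image_eq_zero_of_notMem_tsupport (hnot z hz)
  have hR'' : ∀ z : ℂ, R < ‖z‖ → fderiv ℝ G z = 0 := fun z hz =>
    image_eq_zero_of_notMem_tsupport fun h => hnot z hz (tsupport_fderiv_subset ℝ h)
  have hGf := hG.continuous_fderiv one_ne_zero
  have hnorm : ∀ p : ℝ × ℝ, R < p.1 → R < ‖(p.1 : ℂ) * Complex.exp (p.2 * Complex.I)‖ := by
    intro p hp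
    rw [norm_mul, Complex.norm_exp_ofReal_mul_I, mul_one, Complex.norm_real]
    exact hp.trans_le (le_abs_self _)
  let A : ℝ × ℝ → ℂ := fun p => fderiv ℝ G (p.1 * Complex.exp (p.2 * Complex.I))
    (Complex.exp (p.2 * Complex.I))
  let B : ℝ × ℝ → ℂ := fun p => fderiv ℝ G (p.1 * Complex.exp (p.2 * Complex.I))
    (Complex.I * Complex.exp (p.2 * Complex.I))
  have hA : IntegrableOn A (Ioi (0 : ℝ) ×ˢ Ioo (-Real.pi) Real.pi) := by
    refine integrableOn_polar_of_continuous (by fun_prop) (R := R) fun p hp => ?_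
    simp only [A, hR'' _ (hnorm p hp)]; rfl
  have hB : IntegrableOn B (Ioi (0 : ℝ) ×ˢ Ioo (-Real.pi) Real.pi) := by
    refine integrableOn_polar_of_continuous (by fun_prop) (R := R) fun p hp => ?_
    simp only [B, hR'' _ (hnorm p hp)]; rfl
  have hIA : ∫ p in Ioi (0 : ℝ) ×ˢ Ioo (-Real.pi) Real.pi, A p = -(2 * Real.pi : ℂ) * G 0 := by
    have hA' := hA
    rw [IntegrableOn, Measure.volume_eq_prod, ← Measure.prod_restrict] at hA'
    rw [Measure.volume_eq_prod, ← Measure.prod_restrict, integral_prod_symm _ hA']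
    have : ∀ θ : ℝ, ∫ r in Ioi (0 : ℝ), A (r, θ) = - G 0 := fun θ =>
      integral_radial_fderiv hG hR'' hR' (Complex.norm_exp_ofReal_mul_I θ)
    simp only [this]
    rw [setIntegral_const]
    simp [Real.volume_real_Ioo, Real.pi_pos.le]
    left
    ring
  have hIB : ∫ p in Ioi (0 : ℝ) ×ˢ Ioo (-Real.pi) Real.pi, B p = 0 := by
    rw [Measure.volume_eq_prod, setIntegral_prod _ hB]
    exact setIntegral_eq_zero_of_forall_eq_zero fun r hr => integral_angular_fderiv hG hr
  rw [← Complex.integral_comp_polarCoord_symm]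
  have hcongr : ∀ p ∈ polarCoord.target, p.1 • ((Complex.polarCoord.symm p)⁻¹ *
      dbar G (Complex.polarCoord.symm p)) = (1 / 2 : ℂ) * (A p + Complex.I * B p) := by
    rintro ⟨r, θ⟩ ⟨hr, -⟩
    have hr : (0 : ℝ) < r := hr
    have hr' : (r : ℂ) ≠ 0 := by exact_mod_cast hr.ne'
    have he : (Real.cos θ + Real.sin θ * Complex.I : ℂ) = Complex.exp (θ * Complex.I) := by
      rw [Complex.exp_mul_I, Complex.ofReal_cos, Complex.ofReal_sin]
    have hpol : Complex.polarCoord.symm (r, θ) = r * Complex.exp (θ * Complex.I) := by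
      rw [Complex.polarCoord_symm_apply, he]
    rw [hpol]
    simp only [A, B, dbar]
    set L := fderiv ℝ G (r * Complex.exp (θ * Complex.I))
    have hL : ∀ a b : ℝ, L (a + b * Complex.I) = a * L 1 + b * L Complex.I := by
      intro a b
      have : (a + b * Complex.I : ℂ) = a • (1 : ℂ) + b • Complex.I := by simp
      rw [this, map_add, map_smul, map_smul, Complex.real_smul, Complex.real_smul]
    have h1 : L (Complex.exp (θ * Complex.I)) = Real.cos θ * L 1 + Real.sin θ * L Complex.I := by
      rw [← he, hL]
    have h2 : L (Complex.I * Complex.exp (θ * Complex.I)) =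
        -Real.sin θ * L 1 + Real.cos θ * L Complex.I := by
      have : Complex.I * Complex.exp (θ * Complex.I) =
          ((-Real.sin θ : ℝ) : ℂ) + (Real.cos θ : ℝ) * Complex.I := by
        rw [← he]; push_cast
        linear_combination (Complex.sin θ : ℂ) * Complex.I_mul_I
      rw [this, hL]; push_cast; ring
    have h3 : (Complex.exp (θ * Complex.I))⁻¹ = Real.cos θ - Real.sin θ * Complex.I := by
      rw [← Complex.exp_neg, ← neg_mul, Complex.exp_mul_I]
      simp [Complex.ofReal_cos, Complex.ofReal_sin]; ring
    rw [h1, h2, Complex.real_smul, mul_inv, h3]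
    field_simp
    linear_combination (-(Real.sin θ : ℂ) * L Complex.I) * Complex.I_mul_I
  rw [setIntegral_congr_fun polarCoord.open_target.measurableSet hcongr]
  have ht : polarCoord.target = Ioi (0 : ℝ) ×ˢ Ioo (-Real.pi) Real.pi := rfl
  rw [ht, integral_const_mul, integral_add hA (hB.const_mul _), integral_const_mul, hIA, hIB]
  ring

/-- Compactly supported smooth data for `∂̄` are solved by their Cauchy transform. -/
theorem exists_dbar_eq_of_hasCompactSupport {g : ℂ → ℂ} (hg : ContDiff ℝ (⊤ : ℕ∞) g)
    (hc : HasCompactSupport g) :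
    ∃ u : ℂ → ℂ, ContDiff ℝ (⊤ : ℕ∞) u ∧ ∀ z, dbar u z = g z := by
  let M := ContinuousLinearMap.mul ℝ ℂ
  have hg1 : ContDiff ℝ 1 g := hg.of_le (by simp)
  let v : ℂ → ℂ := (fun z : ℂ => z⁻¹) ⋆[M, volume] g
  have hv : ContDiff ℝ (⊤ : ℕ∞) v :=
    hc.contDiff_convolution_right M locallyIntegrable_inv_complex hg
  have hd : ∀ x e : ℂ, fderiv ℝ v x e = ∫ t : ℂ, t⁻¹ * fderiv ℝ g (x - t) e := by
    intro x e
    rw [(hc.hasFDerivAt_convolution_right M locallyIntegrable_inv_complex hg1 x).fderiv,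
      convolution_precompR_apply M locallyIntegrable_inv_complex (hc.fderiv ℝ)
        (hg1.continuous_fderiv one_ne_zero)]
    rfl
  have hint : ∀ x e : ℂ, Integrable fun t : ℂ => t⁻¹ * fderiv ℝ g (x - t) e := fun x e =>
    (hc.fderiv_apply ℝ e).convolutionExists_right M locallyIntegrable_inv_complex
      ((hg1.continuous_fderiv one_ne_zero).clm_apply continuous_const) x
  have hdv : ∀ x, dbar v x = Real.pi * g x := by
    intro x
    have hG : ContDiff ℝ 1 fun t => g (x - t) := hg1.comp (contDiff_const.sub contDiff_id)
    have hGc : HasCompactSupport fun t => g (x - t) :=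
      hc.comp_homeomorph (Homeomorph.subLeft x)
    have h1 := integral_inv_mul_dbar hG hGc
    have h2 : ∀ t, dbar (fun t => g (x - t)) t = -dbar g (x - t) := by
      intro t
      have : HasFDerivAt (fun t => g (x - t)) (-fderiv ℝ g (x - t)) t := by
        have h := (hg1.differentiable one_ne_zero (x - t)).hasFDerivAt.comp t
          ((hasFDerivAt_id t).const_sub x)
        convert! h using 1
        ext
        simp
      simp only [dbar, this.fderiv, neg_apply]
      ring
    simp only [h2, sub_zero, mul_neg, integral_neg, neg_mul, neg_inj] at h1
    rw [← h1, dbar, hd, hd, ← integral_const_mul, ← integral_add (hint _ _)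
      ((hint _ _).const_mul _), ← integral_const_mul]
    refine integral_congr_ae (Eventually.of_forall fun t => ?_)
    simp only [dbar]
    ring
  have hpi : (Real.pi : ℂ) ≠ 0 := by exact_mod_cast Real.pi_ne_zero
  refine ⟨fun z => (Real.pi : ℂ)⁻¹ * v z, contDiff_const.mul hv, fun z => ?_⟩
  have := (((hv.differentiable (by simp)) z).hasFDerivAt.const_mul (Real.pi : ℂ)⁻¹).fderiv
  have h3 := hdv z
  simp only [dbar, this] at h3 ⊢
  simp only [smul_apply, smul_eq_mul]
  field_simp
  linear_combination 2 * h3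

theorem dbar_mul_of_differentiableAt {g f : ℂ → ℂ} {z : ℂ} (hg : DifferentiableAt ℂ g z)
    (hf : DifferentiableAt ℝ f z) : dbar (fun w => g w * f w) z = g z * dbar f z := by
  have h1 := (hg.hasDerivAt.hasFDerivAt.restrictScalars ℝ).mul hf.hasFDerivAt
  have h2 : fderiv ℝ (fun w => g w * f w) z = _ := h1.fderiv
  simp only [dbar, h2]
  simp
  linear_combination (1 / 2) * (f z * deriv g z) * Complex.I_mul_I

theorem mul_mem_dbarImageAddFlat {Y F : Set ℂ} (hY : IsOpen Y) (hFY : F ⊆ Y) {g : ℂ → ℂ}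
    (hg : DifferentiableOn ℂ g Y) {h k : smoothOnSubmodule Y} (hh : h ∈ dbarImageAddFlat Y F)
    (hk : EqOn (k : ℂ → ℂ) (fun z => g z * (h : ℂ → ℂ) z) Y) : k ∈ dbarImageAddFlat Y F := by
  have hgs : ContDiffOn ℝ (⊤ : ℕ∞) g Y := ((hg.contDiffOn hY).restrict_scalars ℝ)
  induction hh using Submodule.span_induction generalizing k with
  | mem h hh =>
    apply Submodule.subset_span
    rcases hh with ⟨f, hf⟩ | hflat
    · left
      refine ⟨⟨fun z => g z * (f : ℂ → ℂ) z, hgs.mul f.2⟩, fun z hz => ?_⟩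
      have hfz : DifferentiableAt ℝ (f : ℂ → ℂ) z :=
        (ContDiffOn.differentiableOn f.2 (by simp)).differentiableAt (hY.mem_nhds hz)
      refine (hk hz).trans ?_
      change g z * (h : ℂ → ℂ) z = dbar (fun w => g w * (f : ℂ → ℂ) w) z
      rw [hf hz, dbar_mul_of_differentiableAt (hg.differentiableAt (hY.mem_nhds hz)) hfz]
    · right
      intro x hx n
      rw [iteratedFDerivWithin_congr hk (hFY hx), ← norm_le_zero_iff]
      refine (norm_iteratedFDerivWithin_mul_le hgs h.2 hY.uniqueDiffOn (hFY hx)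
        (n := n) (by exact_mod_cast le_top)).trans (le_of_eq ?_)
      refine Finset.sum_eq_zero fun i _ => ?_
      rw [hflat x hx, norm_zero, mul_zero]
  | zero =>
    apply Submodule.subset_span
    left
    refine ⟨0, fun z hz => ?_⟩
    rw [hk hz]
    simp [dbar]
  | add a b _ _ iha ihb =>
    have ha := iha (k := ⟨fun z => g z * (a : ℂ → ℂ) z, hgs.mul a.2⟩) fun _ _ => rfl
    have hb : k - ⟨fun z => g z * (a : ℂ → ℂ) z, hgs.mul a.2⟩ ∈ dbarImageAddFlat Y F := by
      refine ihb fun z hz => ?_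
      simp [hk hz, mul_add]
    simpa using add_mem ha hb
  | smul c a _ iha =>
    have ha := iha (k := ⟨fun z => g z * (a : ℂ → ℂ) z, hgs.mul a.2⟩) fun _ _ => rfl
    have hka : k - c • ⟨fun z => g z * (a : ℂ → ℂ) z, hgs.mul a.2⟩ ∈ dbarImageAddFlat Y F := by
      apply Submodule.subset_span
      left
      refine ⟨0, fun z hz => ?_⟩
      change (k : ℂ → ℂ) z - c * (g z * (a : ℂ → ℂ) z) = dbar (fun _ => 0) z
      rw [hk hz]
      simp [dbar]
      ring
    simpa using add_mem (Submodule.smul_mem _ c ha) hka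

/-- Multiplication by a function holomorphic on `Y`, as an endomorphism of `E(Y)`. -/
noncomputable def mulHolomorphic {Y : Set ℂ} (hY : IsOpen Y) {g : ℂ → ℂ}
    (hg : DifferentiableOn ℂ g Y) : smoothOnSubmodule Y →ₗ[ℂ] smoothOnSubmodule Y where
  toFun f := ⟨fun z => g z * (f : ℂ → ℂ) z, ((hg.contDiffOn hY).restrict_scalars ℝ).mul f.2⟩
  map_add' a b := by
    ext z
    exact mul_add _ _ _
  map_smul' c a := by
    ext z
    exact mul_left_comm _ _ _

theorem mulHolomorphic_apply {Y : Set ℂ} (hY : IsOpen Y) {g : ℂ → ℂ}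
    (hg : DifferentiableOn ℂ g Y) (f : smoothOnSubmodule Y) (z : ℂ) :
    (mulHolomorphic hY hg f : ℂ → ℂ) z = g z * (f : ℂ → ℂ) z := rfl

theorem aeval_mulHolomorphic_id_apply {Y : Set ℂ} (hY : IsOpen Y) (p : Polynomial ℂ)
    (f : smoothOnSubmodule Y) (z : ℂ) :
    (Polynomial.aeval (mulHolomorphic hY differentiableOn_id) p f : ℂ → ℂ) z =
      p.eval z * (f : ℂ → ℂ) z := by
  induction p using Polynomial.induction_on' with
  | add p q hp hq =>
    rw [map_add, Polynomial.eval_add, add_mul, ← hp, ← hq]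
    rfl
  | monomial n a =>
    induction n generalizing a f with
    | zero =>
      simp [Module.algebraMap_end_apply]
    | succ n ih =>
      have : Polynomial.aeval (mulHolomorphic hY differentiableOn_id)
          (Polynomial.monomial (n + 1) a) f =
          Polynomial.aeval (mulHolomorphic hY differentiableOn_id)
          (Polynomial.monomial n a) (mulHolomorphic hY differentiableOn_id f) := by
        simp [Polynomial.aeval_monomial, pow_succ]
      rw [this, ih, mulHolomorphic_apply]
      simp only [Polynomial.eval_monomial, id]
      ring

/-- If `E(Y) / (∂̄(E(Y)) + N_F)` is finite dimensional, it is annihilated by a nonzero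
polynomial. -/
theorem exists_polynomial_mul_mem_dbarImageAddFlat {Y F : Set ℂ} (hY : IsOpen Y) (hFY : F ⊆ Y)
    (hfin : FiniteDimensional ℂ (smoothOnSubmodule Y ⧸ dbarImageAddFlat Y F)) :
    ∃ p : Polynomial ℂ, p ≠ 0 ∧ ∀ f : smoothOnSubmodule Y,
      Polynomial.aeval (mulHolomorphic hY differentiableOn_id) p f ∈ dbarImageAddFlat Y F := by
  set T := mulHolomorphic hY differentiableOn_id
  have hT : dbarImageAddFlat Y F ≤ (dbarImageAddFlat Y F).comap T := fun f hf =>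
    mul_mem_dbarImageAddFlat hY hFY differentiableOn_id hf fun _ _ => rfl
  let T' := (dbarImageAddFlat Y F).mapQ _ T hT
  refine ⟨T'.charpoly, T'.charpoly_monic.ne_zero, fun f => ?_⟩
  have key : ∀ (p : Polynomial ℂ) (f : smoothOnSubmodule Y),
      (dbarImageAddFlat Y F).mkQ (Polynomial.aeval T p f) =
        Polynomial.aeval T' p ((dbarImageAddFlat Y F).mkQ f) := by
    intro p f
    induction p using Polynomial.induction_on' with
    | add p q hp hq => simp only [map_add, LinearMap.add_apply, hp, hq]
    | monomial n a =>
      induction n generalizing f with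
      | zero => simp [Module.algebraMap_end_apply]
      | succ n ih =>
        have h1 : Polynomial.aeval T (Polynomial.monomial (n + 1) a) f =
            Polynomial.aeval T (Polynomial.monomial n a) (T f) := by
          simp [Polynomial.aeval_monomial, pow_succ]
        have h2 : ∀ v, Polynomial.aeval T' (Polynomial.monomial (n + 1) a) v =
            Polynomial.aeval T' (Polynomial.monomial n a) (T' v) := by
          simp [Polynomial.aeval_monomial, pow_succ]
        rw [h1, h2, ih]
        rfl
  rw [← Submodule.Quotient.mk_eq_zero]
  refine (key _ f).trans ?_
  rw [LinearMap.aeval_self_charpoly]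
  rfl

/-- Modulo `∂̄(E(Y))`, every smooth function on `Y` is divisible by a given nonzero polynomial. -/
theorem exists_eqOn_dbar_add_polynomial_mul {Y : Set ℂ} (hY : IsOpen Y) {p : Polynomial ℂ}
    (hp : p ≠ 0) (h : smoothOnSubmodule Y) :
    ∃ u k : smoothOnSubmodule Y,
      ∀ z ∈ Y, (h : ℂ → ℂ) z = dbar u z + p.eval z * (k : ℂ → ℂ) z := by
  have hZ : {z | p.eval z = 0}.Finite := by
    refine p.roots.toFinset.finite_toSet.subset fun z hz => ?_
    simpa [hp] using hz
  obtain ⟨K, hK, hZK, hKY⟩ := exists_compact_between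
    (hZ.subset (inter_subset_left (t := Y))).isCompact hY inter_subset_right
  obtain ⟨χ, hχ1, hχ0, -⟩ := exists_contMDiffMap_one_nhds_of_subset_interior
    (n := ⊤) (modelWithCornersSelf ℝ ℂ)
    (hZ.subset (inter_subset_left (t := Y))).isClosed hZK
  have hχ : ContDiff ℝ (⊤ : ℕ∞) fun z => (χ z : ℂ) :=
    Complex.ofRealCLM.contDiff.comp χ.contMDiff.contDiff
  have hsupp : tsupport (fun z => (χ z : ℂ) * (h : ℂ → ℂ) z) ⊆ K := by
    refine closure_minimal (fun z hz => ?_) hK.isClosed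
    by_contra hzK
    exact hz (by simp [hχ0 z hzK])
  have hsmooth : ContDiff ℝ (⊤ : ℕ∞) fun z => (χ z : ℂ) * (h : ℂ → ℂ) z := by
    refine ContMDiff.contDiff (contMDiff_of_tsupport fun z hz => ContDiffAt.contMDiffAt ?_)
    exact (hχ.contDiffAt).mul (ContDiffOn.contDiffAt h.2 (hY.mem_nhds (hKY (hsupp hz))))
  obtain ⟨u, hu, hdu⟩ := exists_dbar_eq_of_hasCompactSupport hsmooth
    (hK.of_isClosed_subset (isClosed_tsupport _) hsupp)
  refine ⟨⟨u, hu.contDiffOn⟩,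
    ⟨fun z => (1 - (χ z : ℂ)) * (h : ℂ → ℂ) z * (p.eval z)⁻¹, fun z hz => ?_⟩, fun z hz => ?_⟩
  · apply ContDiffAt.contDiffWithinAt
    by_cases hpz : p.eval z = 0
    · refine (contDiffAt_const (c := (0 : ℂ))).congr_of_eventuallyEq ?_
      filter_upwards [(eventually_nhdsSet_iff_forall.1 hχ1) z ⟨hpz, hz⟩] with w hw
      simp [hw]
    · have hps : ContDiff ℝ (⊤ : ℕ∞) fun z => p.eval z :=
        p.contDiff_aeval (𝕜 := ℂ) _ |>.restrict_scalars ℝ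
      exact ((contDiffAt_const.sub hχ.contDiffAt).mul
        (ContDiffOn.contDiffAt h.2 (hY.mem_nhds hz))).mul (hps.contDiffAt.inv hpz)
  · change (h : ℂ → ℂ) z = dbar u z + p.eval z * ((1 - (χ z : ℂ)) * (h : ℂ → ℂ) z * (p.eval z)⁻¹)
    rw [hdu]
    by_cases hpz : p.eval z = 0
    · have : χ z = 1 := ((eventually_nhdsSet_iff_forall.1 hχ1) z ⟨hpz, hz⟩).self_of_nhds
      simp [this, hpz]
    · field_simp
      ring

/-- Let `Y ⊆ ℂ` be open and `F ⊆ Y` closed in `Y`.  The Whitney Dolbeault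
cohomology group `H^{0,1}(𝔚_F) = E(Y) / (∂̄(E(Y)) + N_F)` is either zero or infinite
dimensional over `ℂ`: if it is finite dimensional, it vanishes. -/
theorem whitney_dolbeault_zero_of_finiteDimensional
    (Y : Set ℂ) (hY : IsOpen Y) (F : Set ℂ) (hFY : F ⊆ Y)
    (hFcl : closure F ∩ Y = F)
    (hfin : FiniteDimensional ℂ (smoothOnSubmodule Y ⧸ dbarImageAddFlat Y F)) :
    Subsingleton (smoothOnSubmodule Y ⧸ dbarImageAddFlat Y F) := by
  rw [Submodule.Quotient.subsingleton_iff, eq_top_iff]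
  rintro h -
  obtain ⟨p, hp, hpf⟩ := exists_polynomial_mul_mem_dbarImageAddFlat hY hFY hfin
  obtain ⟨u, k, huk⟩ := exists_eqOn_dbar_add_polynomial_mul hY hp h
  have h1 : h - Polynomial.aeval (mulHolomorphic hY differentiableOn_id) p k ∈
      dbarImageAddFlat Y F := by
    apply Submodule.subset_span
    left
    refine ⟨u, fun z hz => ?_⟩
    change (h : ℂ → ℂ) z - _ = _
    rw [aeval_mulHolomorphic_id_apply, huk z hz, add_sub_cancel_right]
  simpa using add_mem h1 (hpf k)
end
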